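/- Let G be a finite simple graph containing edges xy and x'y' whose four endpoints x, y, x', y' are pairwise distinct, such that xx' is NOT an edge of G but each of xy', x'y, yy' is an edge of G (i.e., the crossing of xy and x'y' is almost full with missing pair xx'). Let G' be the graph obtained from G by deleting the edges xy and x'y' and adding a new vertex v adjacent exactly to x, y, x', y'. If G' has a Hamiltonian path that does not contain both of the edges vx and vx', then G has a Hamiltonian path. -/

import Mathlib

open SimpleGraph

/-- The graph obtained from `G` by deleting the edges `xy` and `x'y'` and adding a new
vertex (`none`) adjacent exactly to `x`, `y`, `x'`, `y'`. -/
def addCrossingVertex {V : Type*} (G : SimpleGraph V) (x y x' y' : V) :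
    SimpleGraph (Option V) :=
  SimpleGraph.map Function.Embedding.some (G.deleteEdges {s(x, y), s(x', y')}) ⊔
    SimpleGraph.fromEdgeSet {s((none : Option V), some x), s(none, some y),
      s(none, some x'), s(none, some y')}

namespace SimpleGraph

variable {V : Type*}

lemma Walk.isChain_mem_edges_support {G : SimpleGraph V} {u v : V} (p : G.Walk u v) :
    p.support.IsChain fun a b => s(a, b) ∈ p.edges := by
  induction p with
  | nil => simp
  | cons h p ih =>
    have ih' := ih.imp (S := fun a b => s(a, b) ∈ (Walk.cons h p).edges)
      fun a b hab => by simp [hab]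
    rw [support_cons]
    cases p <;> simp_all

lemma exists_isHamiltonian_of_isChain [DecidableEq V] {G : SimpleGraph V} {l : List V}
    (hne : l ≠ []) (hchain : l.IsChain G.Adj) (hnodup : l.Nodup) (hmem : ∀ v, v ∈ l) :
    ∃ (a b : V) (p : G.Walk a b), p.IsHamiltonian :=
  ⟨_, _, .ofSupport l hne hchain, fun v => by
    rw [Walk.support_ofSupport, List.count_eq_one_of_mem hnodup (hmem v)]⟩

/-- A Hamiltonian path on `Option V` restricts to one on `V` if its edges between vertices of `V`
are edges of `G` and the two neighbours of `none` on the path, if both exist, are adjacent. -/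
lemma exists_isHamiltonian_of_option [DecidableEq V] [Nonempty V] {G : SimpleGraph V}
    {H : SimpleGraph (Option V)} {a b : Option V} (p : H.Walk a b) (hp : p.IsHamiltonian)
    (hsome : ∀ u v : V, H.Adj (some u) (some v) → G.Adj u v)
    (hnone : ∀ u v : V, u ≠ v → s(none, some u) ∈ p.edges → s(none, some v) ∈ p.edges →
      G.Adj u v) :
    ∃ (a b : V) (p : G.Walk a b), p.IsHamiltonian := by
  obtain ⟨A, B, hs⟩ := List.append_of_mem (hp.mem_support none)
  have hchain := p.isChain_mem_edges_support
  have hnd := hp.isPath.support_nodup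
  have hmem (w : V) : some w ∈ A ++ none :: B := hs ▸ hp.mem_support (some w)
  rw [hs] at hchain hnd
  have hn : none ∉ A ++ B := (List.nodup_middle.1 hnd).notMem
  rw [List.mem_append, not_or] at hn
  have lift_some (L : List (Option V)) (hL : none ∉ L) : ∃ l : List V, l.map some = L := by
    rw [← Set.mem_range, Set.range_list_map]
    intro w hw
    cases w with
    | none => exact absurd hw hL
    | some w => exact ⟨w, rfl⟩
  obtain ⟨l, rfl⟩ := lift_some A hn.1
  obtain ⟨m, rfl⟩ := lift_some B hn.2
  have hnodup : (l ++ m).Nodup := by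
    have := (List.nodup_middle.1 hnd).of_cons
    rw [← List.map_append] at this
    exact this.of_map some
  have hmem_append (w : V) : w ∈ l ++ m := by simpa using hmem w
  have hedge (u v : V) (h : s(some u, some v) ∈ p.edges) : G.Adj u v :=
    hsome u v (p.adj_of_mem_edges h)
  rw [List.isChain_append, List.isChain_map] at hchain
  obtain ⟨hl, hm, hlast⟩ := hchain
  rw [List.isChain_cons, List.isChain_map] at hm
  refine exists_isHamiltonian_of_isChain (l := l ++ m) ?_ ?_ hnodup hmem_append
  · rintro h
    simpa [h] using hmem_append (Classical.arbitrary V)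
  · refine List.isChain_append.2 ⟨hl.imp hedge, hm.2.imp hedge, fun u hu v hv => ?_⟩
    refine hnone u v ?_ ?_ ?_
    · exact (List.nodup_append.1 hnodup).2.2 u (List.mem_of_mem_getLast? hu) v
        (List.mem_of_mem_head? hv)
    · rw [Sym2.eq_swap]
      exact hlast (some u) (by simpa using hu) none (by simp)
    · exact hm.1 (some v) (by simpa using hv)

lemma addCrossingVertex_adj_some {G : SimpleGraph V} {x y x' y' u v : V}
    (h : (addCrossingVertex G x y x' y').Adj (some u) (some v)) : G.Adj u v := by
  simp only [addCrossingVertex, sup_adj, map_adj, fromEdgeSet_adj] at h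
  rcases h with ⟨a, b, hab, ha, hb⟩ | h
  · cases ha
    cases hb
    exact (deleteEdges_adj.1 hab).1
  · simp at h

lemma addCrossingVertex_adj_none {G : SimpleGraph V} {x y x' y' u : V}
    (h : (addCrossingVertex G x y x' y').Adj none (some u)) :
    u = x ∨ u = y ∨ u = x' ∨ u = y' := by
  simp only [addCrossingVertex, sup_adj, map_adj, fromEdgeSet_adj] at h
  rcases h with ⟨a, b, -, ha, -⟩ | h
  · cases ha
  · simpa using h

end SimpleGraph

/-- If the crossing of `xy` and `x'y'` is almost full with missing pair `xx'`, and the graph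
`G'` obtained by turning the crossing into a new 4-valent vertex `v = none` has a Hamiltonian
path not containing both edges `vx` and `vx'`, then `G` has a Hamiltonian path. -/
theorem almost_full_crossing_hamiltonian_path {V : Type*} [Fintype V] [DecidableEq V]
    (G : SimpleGraph V) (x y x' y' : V)
    (hxy : x ≠ y) (hxx'ne : x ≠ x') (hxy' : x ≠ y') (hyx' : y ≠ x') (hyy' : y ≠ y')
    (hx'y' : x' ≠ y')
    (e1 : G.Adj x y) (e2 : G.Adj x' y')
    (hxx' : ¬ G.Adj x x') (f2 : G.Adj x y') (f3 : G.Adj y x') (f4 : G.Adj y y')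
    (hham : ∃ (a b : Option V) (p : (addCrossingVertex G x y x' y').Walk a b),
      p.IsHamiltonian ∧
        ¬(s((none : Option V), some x) ∈ p.edges ∧ s((none : Option V), some x') ∈ p.edges)) :
    ∃ (a b : V) (p : G.Walk a b), p.IsHamiltonian := by
  obtain ⟨a, b, p, hp, hnot⟩ := hham
  have : Nonempty V := ⟨x⟩
  refine exists_isHamiltonian_of_option p hp (fun _ _ => addCrossingVertex_adj_some) ?_
  intro u v huv hu hv
  rcases addCrossingVertex_adj_none (p.adj_of_mem_edges hu) with rfl | rfl | rfl | rfl <;>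
    rcases addCrossingVertex_adj_none (p.adj_of_mem_edges hv) with rfl | rfl | rfl | rfl <;>
    first
    | assumption
    | exact Adj.symm (by assumption)
    | exact absurd rfl huv
    | exact absurd (And.intro (by assumption) (by assumption)) hnot
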